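/- Let 1 ≤ k ≤ d and let S be a k-element subset of ZMod d whose translation stabilizer has order e. Then ∑_{S'} ∏_{s ∈ S'} η_s = (1/e)·(p·z(S) − m^{k−1}), where the sum runs over the distinct subsets S' in the translation orbit {ν + S : ν ∈ ZMod d} of S (an orbit of size d/e). -/

import Mathlib

/-- The coset `C_s = g^s · C₀` (as a subset of `ZMod p`) of the subgroup `C₀` of
d-th powers of units, for `s : ZMod d`. -/
def Cset (p d : ℕ) [NeZero p] (g : (ZMod p)ˣ) (s : ZMod d) : Finset (ZMod p) :=
  Finset.univ.filter fun x : ZMod p =>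
    ∃ y : (ZMod p)ˣ, x = (g : ZMod p) ^ s.val * (y : ZMod p) ^ d

/-- The Gauss d-period `η_j = ∑_{x ∈ C_j} ζ^x`. -/
noncomputable def eta (p d : ℕ) [NeZero p] (g : (ZMod p)ˣ) (ζ : ℂ) (j : ZMod d) : ℂ :=
  ∑ x ∈ Cset p d g j, ζ ^ x.val

/-- The Gauss symbol `N(S)`. -/
noncomputable def gaussN (p d : ℕ) [NeZero p] (g : (ZMod p)ˣ) (S : Finset (ZMod d)) : ℕ :=
  Nat.card {f : S → ZMod p //
    (∀ s : S, f s ∈ Cset p d g (s : ZMod d)) ∧ ∑ s : S, f s = 0}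

/-- The translation stabilizer `{ν ∈ ZMod d : ν + S = S}` of a subset `S ⊆ ZMod d`. -/
def stabF {d : ℕ} [NeZero d] (S : Finset (ZMod d)) : Finset (ZMod d) :=
  Finset.univ.filter fun ν => S.image (fun s => ν + s) = S

/-- The translation orbit `{ν + S : ν ∈ ZMod d}` of a subset `S ⊆ ZMod d`. -/
def orbF {d : ℕ} [NeZero d] (S : Finset (ZMod d)) : Finset (Finset (ZMod d)) :=
  Finset.univ.image fun ν => S.image (fun s => ν + s)

section Cyclotomy

variable {p d : ℕ} [Fact p.Prime] {g : (ZMod p)ˣ}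

lemma natCast_eq_of_pow_eq (hd : d ∣ p - 1) (hg : ∀ x : (ZMod p)ˣ, ∃ n : ℕ, g ^ n = x)
    {a b : ℕ} (h : g ^ a = g ^ b) : (a : ZMod d) = b := by
  have ho : orderOf g = p - 1 := by
    rw [orderOf_eq_card_of_forall_mem_zpowers, Nat.card_eq_fintype_card, ZMod.card_units]
    intro x
    obtain ⟨n, rfl⟩ := hg x
    exact Subgroup.npow_mem_zpowers g n
  rw [ZMod.natCast_eq_natCast_iff]
  rw [pow_eq_pow_iff_modEq, ho] at h
  exact h.of_dvd hd

lemma mem_Cset_iff [NeZero d] (hg : ∀ x : (ZMod p)ˣ, ∃ n : ℕ, g ^ n = x)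
    {s : ZMod d} {x : ZMod p} :
    x ∈ Cset p d g s ↔ ∃ n : ℕ, x = ((g ^ n : (ZMod p)ˣ) : ZMod p) ∧ (n : ZMod d) = s := by
  simp only [Cset, Finset.mem_filter, Finset.mem_univ, true_and]
  constructor
  · rintro ⟨y, rfl⟩
    obtain ⟨t, rfl⟩ := hg y
    refine ⟨s.val + t * d, ?_, ?_⟩
    · push_cast
      rw [pow_add, pow_mul]
    · simp
  · rintro ⟨n, rfl, rfl⟩
    refine ⟨g ^ (n / d), ?_⟩
    rw [ZMod.val_natCast]
    push_cast
    rw [← pow_mul, ← pow_add, mul_comm, Nat.mod_add_div]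

lemma mul_mem_Cset [NeZero d] (hg : ∀ x : (ZMod p)ˣ, ∃ n : ℕ, g ^ n = x)
    {s t : ZMod d} {x y : ZMod p} (hx : x ∈ Cset p d g s) (hy : y ∈ Cset p d g t) :
    x * y ∈ Cset p d g (s + t) := by
  rw [mem_Cset_iff hg] at *
  obtain ⟨a, rfl, rfl⟩ := hx
  obtain ⟨b, rfl, rfl⟩ := hy
  exact ⟨a + b, by rw [pow_add, Units.val_mul], by push_cast; rfl⟩

lemma ne_zero_of_mem_Cset [NeZero d] (hg : ∀ x : (ZMod p)ˣ, ∃ n : ℕ, g ^ n = x)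
    {s : ZMod d} {x : ZMod p} (hx : x ∈ Cset p d g s) : x ≠ 0 := by
  obtain ⟨a, rfl, -⟩ := (mem_Cset_iff hg).1 hx
  exact Units.ne_zero _

lemma exists_mul_eq_of_mem_Cset [NeZero d] (hd : d ∣ p - 1)
    (hg : ∀ x : (ZMod p)ˣ, ∃ n : ℕ, g ^ n = x)
    {s t : ZMod d} {x y : ZMod p} (hx : x ∈ Cset p d g s) (hy : y ∈ Cset p d g t) :
    ∃ c ∈ Cset p d g (t - s), y = c * x := by
  obtain ⟨a, rfl, rfl⟩ := (mem_Cset_iff hg).1 hx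
  obtain ⟨b, rfl, rfl⟩ := (mem_Cset_iff hg).1 hy
  obtain ⟨n, hn⟩ := hg (g ^ b * (g ^ a)⁻¹)
  have h : g ^ (n + a) = g ^ b := by rw [pow_add, hn, inv_mul_cancel_right]
  refine ⟨_, (mem_Cset_iff hg).2 ⟨n, rfl, ?_⟩, ?_⟩
  · rw [eq_sub_iff_add_eq, ← Nat.cast_add]
    exact natCast_eq_of_pow_eq hd hg h
  · rw [← h, pow_add, Units.val_mul]

lemma image_mul_Cset [NeZero d] (hd : d ∣ p - 1)
    (hg : ∀ x : (ZMod p)ˣ, ∃ n : ℕ, g ^ n = x)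
    {s t : ZMod d} {a : ZMod p} (ha : a ∈ Cset p d g t) :
    (Cset p d g s).image (· * a) = Cset p d g (t + s) := by
  ext y
  rw [Finset.mem_image]
  constructor
  · rintro ⟨x, hx, rfl⟩
    rw [add_comm]
    exact mul_mem_Cset hg hx ha
  · intro hy
    obtain ⟨c, hc, rfl⟩ := exists_mul_eq_of_mem_Cset hd hg ha hy
    exact ⟨c, by simpa using hc, rfl⟩

lemma sum_Cset_mul [NeZero d] {M : Type*} [AddCommMonoid M] (hd : d ∣ p - 1)
    (hg : ∀ x : (ZMod p)ˣ, ∃ n : ℕ, g ^ n = x)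
    {s t : ZMod d} {a : ZMod p} (ha : a ∈ Cset p d g t) (F : ZMod p → M) :
    ∑ x ∈ Cset p d g s, F (x * a) = ∑ x ∈ Cset p d g (t + s), F x := by
  rw [← image_mul_Cset hd hg ha, Finset.sum_image]
  exact fun x _ y _ h => mul_right_cancel₀ (ne_zero_of_mem_Cset hg ha) h

lemma sum_eq_zero_add_sum_Cset [NeZero d] {M : Type*} [AddCommMonoid M] (hd : d ∣ p - 1)
    (hg : ∀ x : (ZMod p)ˣ, ∃ n : ℕ, g ^ n = x) (F : ZMod p → M) :
    ∑ a, F a = F 0 + ∑ t : ZMod d, ∑ a ∈ Cset p d g t, F a := by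
  rw [← Finset.add_sum_erase _ _ (Finset.mem_univ (0 : ZMod p)), ← Finset.sum_biUnion]
  · congr 2
    ext x
    simp only [Finset.mem_erase, Finset.mem_univ, and_true, Finset.mem_biUnion, true_and]
    constructor
    · intro hx
      obtain ⟨n, hn⟩ := hg (Units.mk0 x hx)
      exact ⟨n, (mem_Cset_iff hg).2 ⟨n, by rw [hn, Units.val_mk0], rfl⟩⟩
    · rintro ⟨t, ht⟩
      exact ne_zero_of_mem_Cset hg ht
  · intro s _ t _ hst
    refine Finset.disjoint_left.2 fun x hx hy => hst ?_
    obtain ⟨a, rfl, rfl⟩ := (mem_Cset_iff hg).1 hx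
    obtain ⟨b, hb, rfl⟩ := (mem_Cset_iff hg).1 hy
    exact natCast_eq_of_pow_eq hd hg (Units.ext hb)

lemma card_Cset [NeZero d] {m : ℕ} (hdm : p - 1 = d * m)
    (hg : ∀ x : (ZMod p)ˣ, ∃ n : ℕ, g ^ n = x) (s : ZMod d) :
    (Cset p d g s).card = m := by
  have hd : d ∣ p - 1 := ⟨m, hdm⟩
  have hcard (t : ZMod d) : (Cset p d g t).card = (Cset p d g s).card := by
    have ha : ((g ^ (t - s).val : (ZMod p)ˣ) : ZMod p) ∈ Cset p d g (t - s) :=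
      (mem_Cset_iff hg).2 ⟨_, rfl, by simp⟩
    simpa only [Finset.card_eq_sum_ones, sub_add_cancel] using
      (sum_Cset_mul (s := s) hd hg ha fun _ => 1).symm
  have h := sum_eq_zero_add_sum_Cset hd hg fun _ => 1
  simp only [Finset.sum_const, smul_eq_mul, mul_one, hcard, Finset.card_univ, ZMod.card] at h
  have h' : d * (Cset p d g s).card = d * m := by omega
  exact Nat.eq_of_mul_eq_mul_left (NeZero.pos d) h'

lemma gaussN_eq_card (S : Finset (ZMod d)) :
    gaussN p d g S =
      {f ∈ Fintype.piFinset fun s : S => Cset p d g s | ∑ s, f s = 0}.card := by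
  rw [gaussN, Nat.card_eq_fintype_card]
  exact Fintype.card_of_subtype _ fun f => by
    rw [Finset.mem_filter, Fintype.mem_piFinset]

lemma dvd_gaussN [NeZero d] {m : ℕ} (hdm : p - 1 = d * m)
    (hg : ∀ x : (ZMod p)ˣ, ∃ n : ℕ, g ^ n = x) {S : Finset (ZMod d)} (hS : S.Nonempty) :
    m ∣ gaussN p d g S := by
  obtain ⟨s₀, hs₀⟩ := hS
  set A := {f ∈ Fintype.piFinset fun s : S => Cset p d g s | ∑ s, f s = 0} with hA
  have hle : ∀ x ∈ Cset p d g s₀, ∀ y ∈ Cset p d g s₀,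
      {f ∈ A | f ⟨s₀, hs₀⟩ = x}.card ≤ {f ∈ A | f ⟨s₀, hs₀⟩ = y}.card := by
    intro x hx y hy
    obtain ⟨c, hc, rfl⟩ := exists_mul_eq_of_mem_Cset ⟨m, hdm⟩ hg hx hy
    rw [sub_self] at hc
    refine Finset.card_le_card_of_injOn (fun f s => c * f s) ?_ ?_
    · intro f hf
      simp only [hA, Finset.coe_filter, Set.mem_ofPred_eq, Finset.mem_filter,
        Fintype.mem_piFinset] at hf ⊢
      obtain ⟨⟨hf, hsum⟩, rfl⟩ := hf
      refine ⟨⟨fun s => ?_, ?_⟩, rfl⟩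
      · simpa using mul_mem_Cset hg hc (hf s)
      · rw [← Finset.mul_sum, hsum, mul_zero]
    · intro f _ f' _ h
      funext s
      exact mul_left_cancel₀ (ne_zero_of_mem_Cset hg hc) (congrFun h s)
  have hx₀ : ((g ^ s₀.val : (ZMod p)ˣ) : ZMod p) ∈ Cset p d g s₀ :=
    (mem_Cset_iff hg).2 ⟨_, rfl, by simp⟩
  rw [gaussN_eq_card, ← hA, Finset.card_eq_sum_card_fiberwise (f := fun f => f ⟨s₀, hs₀⟩)
    (t := Cset p d g s₀) fun f hf =>
      Fintype.mem_piFinset.1 (Finset.mem_filter.1 hf).1 ⟨s₀, hs₀⟩,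
    Finset.sum_congr rfl fun x hx => le_antisymm (hle x hx _ hx₀) (hle _ hx₀ x hx),
    Finset.sum_const, card_Cset hdm hg, smul_eq_mul]
  exact dvd_mul_right _ _

lemma mul_gaussN_eq_sum {ζ : ℂ} (hζ : IsPrimitiveRoot ζ p) (S : Finset (ZMod d)) :
    (p : ℂ) * gaussN p d g S =
      ∑ a : ZMod p, ∏ s ∈ S, ∑ x ∈ Cset p d g s, ζ ^ (x * a).val := by
  have hψ := AddChar.zmodChar_primitive_of_primitive_root p hζ
  set ψ := AddChar.zmodChar p hζ.pow_eq_one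
  have hval (x : ZMod p) : ζ ^ x.val = ψ x := (AddChar.zmodChar_apply _ x).symm
  calc (p : ℂ) * gaussN p d g S
      = ∑ f ∈ Fintype.piFinset fun s : S => Cset p d g s,
          ∑ a : ZMod p, ψ (a * ∑ s, f s) := by
        simp only [AddChar.sum_mulShift _ hψ]
        rw [gaussN_eq_card, Finset.card_filter]
        push_cast
        rw [Finset.mul_sum]
        refine Finset.sum_congr rfl fun f _ => ?_
        rw [ZMod.card]
        split_ifs <;> simp
    _ = ∑ a : ZMod p, ∏ s : S, ∑ x ∈ Cset p d g s, ζ ^ (x * a).val := by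
        rw [Finset.sum_comm]
        refine Finset.sum_congr rfl fun a _ => ?_
        rw [Finset.prod_univ_sum]
        refine Finset.sum_congr rfl fun f _ => ?_
        calc ψ (a * ∑ s, f s) = ∏ s, ψ (a * f s) := by
              rw [Finset.mul_sum]
              exact map_prod ψ.toMonoidHom (fun s => Multiplicative.ofAdd (a * f s)) _
          _ = _ := Finset.prod_congr rfl fun s _ => by rw [hval, mul_comm]
    _ = _ := by
        refine Finset.sum_congr rfl fun a _ => ?_
        exact Finset.prod_coe_sort S fun s => ∑ x ∈ Cset p d g s, ζ ^ (x * a).val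

lemma mul_gaussN_eq [NeZero d] {m : ℕ} (hdm : p - 1 = d * m)
    (hg : ∀ x : (ZMod p)ˣ, ∃ n : ℕ, g ^ n = x) {ζ : ℂ} (hζ : IsPrimitiveRoot ζ p)
    (S : Finset (ZMod d)) :
    (p : ℂ) * gaussN p d g S =
      (m : ℂ) ^ S.card + m * ∑ ν : ZMod d, ∏ s ∈ S, eta p d g ζ (ν + s) := by
  have hd : d ∣ p - 1 := ⟨m, hdm⟩
  rw [mul_gaussN_eq_sum hζ, sum_eq_zero_add_sum_Cset hd hg, Finset.mul_sum]
  congr 1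
  · simp [card_Cset hdm hg]
  · refine Finset.sum_congr rfl fun ν _ => ?_
    rw [Finset.sum_congr rfl fun a ha => Finset.prod_congr rfl fun s _ =>
      sum_Cset_mul hd hg ha fun x => ζ ^ x.val, Finset.sum_const, card_Cset hdm hg, nsmul_eq_mul]
    rfl

end Cyclotomy

lemma sum_translates_eq_card_stabF_mul {d : ℕ} [NeZero d] {R : Type*} [CommSemiring R]
    (S : Finset (ZMod d)) (F : Finset (ZMod d) → R) :
    ∑ ν : ZMod d, F (S.image fun s => ν + s) = (stabF S).card * ∑ S' ∈ orbF S, F S' := by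
  rw [← Finset.sum_fiberwise_of_maps_to (t := orbF S) (g := fun ν => S.image fun s => ν + s)
    (fun ν _ => Finset.mem_image_of_mem _ (Finset.mem_univ ν)), Finset.mul_sum]
  refine Finset.sum_congr rfl fun T hT => ?_
  obtain ⟨μ, -, rfl⟩ := Finset.mem_image.1 hT
  rw [Finset.sum_congr rfl fun ν hν => by rw [(Finset.mem_filter.1 hν).2], Finset.sum_const,
    nsmul_eq_mul]
  congr 2
  refine (Finset.card_bij (fun ν _ => μ + ν) ?_ (fun _ _ _ _ h => add_left_cancel h) ?_).symm
  · intro ν hν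
    have h := (Finset.mem_filter.1 hν).2
    refine Finset.mem_filter.2 ⟨Finset.mem_univ _, ?_⟩
    conv_rhs => rw [← h, Finset.image_image]
    simp only [Function.comp_def, add_assoc]
  · intro ν hν
    have h := (Finset.mem_filter.1 hν).2
    refine ⟨-μ + ν, Finset.mem_filter.2 ⟨Finset.mem_univ _, ?_⟩, by simp⟩
    have h' := congrArg (Finset.image fun s => -μ + s) h
    simp only [Finset.image_image, Function.comp_def, neg_add_cancel_left, Finset.image_id'] at h'
    simpa only [add_assoc] using h'

/-- if the k-element subset S of ZMod d has translation stabilizer of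
order e, then ∑_{S' ∈ orbit of S} ∏_{s ∈ S'} η_s = (1/e)·(p·z(S) − m^{k−1}),
where z(S) = N(S)/m. -/
theorem orbit_period_sum (p d m k e : ℕ) [Fact p.Prime] [NeZero d] (hp : Odd p)
    (hd1 : 1 ≤ d) (hdm : p - 1 = d * m)
    (g : (ZMod p)ˣ) (hg : ∀ x : (ZMod p)ˣ, ∃ n : ℕ, g ^ n = x)
    (ζ : ℂ) (hζ : IsPrimitiveRoot ζ p)
    (hk1 : 1 ≤ k) (hkd : k ≤ d)
    (S : Finset (ZMod d)) (hS : S.card = k) (he : (stabF S).card = e) :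
    ∑ S' ∈ orbF S, ∏ s ∈ S', eta p d g ζ s
      = (1 / (e : ℂ)) * ((p : ℂ) * ((gaussN p d g S / m : ℕ) : ℂ) - (m : ℂ) ^ (k - 1)) := by
  subst hS he
  have hm : (m : ℂ) ≠ 0 := by
    rintro h
    have hm0 : m = 0 := by exact_mod_cast h
    have := (Fact.out : p.Prime).two_le
    rw [hm0] at hdm
    omega
  have he : ((stabF S).card : ℂ) ≠ 0 := by
    rw [Nat.cast_ne_zero, ← Nat.pos_iff_ne_zero]
    exact Finset.card_pos.2 ⟨0, by simp only [stabF, Finset.mem_filter, Finset.mem_univ, zero_add,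
      Finset.image_id', and_self]⟩
  have h := mul_gaussN_eq hdm hg hζ S
  have horb := sum_translates_eq_card_stabF_mul S fun T => ∏ s ∈ T, eta p d g ζ s
  simp only [Finset.prod_image fun _ _ _ _ h => add_left_cancel h] at horb
  rw [Nat.cast_div (dvd_gaussN hdm hg (Finset.card_pos.1 hk1)) hm, one_div,
    eq_inv_mul_iff_mul_eq₀ he, ← horb, eq_sub_iff_add_eq, ← mul_div_assoc, eq_div_iff hm, h,
    add_mul, pow_sub_one_mul (Nat.one_le_iff_ne_zero.1 hk1)]
  ring
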